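/- arXiv:1906.01030 — 4 statements merged into one kernel-verified Lean document; each statement's English description precedes it below -/
import Mathlib

section
/- Local error bound for regression (Theorem 1). For every feasible input x ∈ X̃ and every possible ground truth y ∈ f̂(x), there exists an index i such that x ∈ Bᵢ and |f(x) − y| ≤ eᵢ; consequently |f(x) − y| ≤ e_local(x), where e_local(x) is the maximum of eᵢ over all indices i with x ∈ Bᵢ. -/
open scoped Classical

/-- **Local error bound for regression (Theorem 1).**
For every feasible input `x ∈ X̃` and every possible ground truth `y ∈ f̂ x`,
there exists an index `i` with `x ∈ B i` and `|f x - y| ≤ e i`; consequently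
`|f x - y| ≤ e_local x`, where `e_local x` is the maximum of `e i` over all
indices `i` with `x ∈ B i`. -/
theorem local_error_bound_regression
    {X : Type*} {ι : Type*} [Fintype ι]
    (Xfeas : Set X) (fhat : X → Set ℝ) (f : X → ℝ)
    (T : ι → Set X) (l u : ι → ℝ) (B : ι → Set X) (l' u' : ι → ℝ)
    (e : ι → ℝ) (he : ∀ i, e i = max (u' i - l i) (u i - l' i))
    (h41 : Xfeas ⊆ ⋃ i, T i)
    (h42a : ∀ x ∈ Xfeas, ∀ y ∈ fhat x, ∃ i, x ∈ T i ∧ l i ≤ y ∧ y ≤ u i)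
    (h43 : ∀ i, T i ⊆ B i)
    (h44a : ∀ i, ∀ x ∈ B i, l' i ≤ f x ∧ f x ≤ u' i)
    (x : X) (hx : x ∈ Xfeas) (y : ℝ) (hy : y ∈ fhat x) :
    (∃ i, x ∈ B i ∧ |f x - y| ≤ e i) ∧
    ∃ hne : (Finset.univ.filter fun i => x ∈ B i).Nonempty,
      |f x - y| ≤ (Finset.univ.filter fun i => x ∈ B i).sup' hne e := by
  obtain ⟨i, hxT, hly, hyu⟩ := h42a x hx y hy
  have hxB : x ∈ B i := h43 i hxT
  obtain ⟨hlf, hfu⟩ := h44a i x hxB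
  have hbound : |f x - y| ≤ e i := by
    rw [he i, abs_sub_le_iff]
    exact ⟨(sub_le_sub hfu hly).trans (le_max_left _ _),
      (sub_le_sub hyu hlf).trans (le_max_right _ _)⟩
  have hmem : i ∈ Finset.univ.filter fun i => x ∈ B i := by simpa using hxB
  exact ⟨⟨i, hxB, hbound⟩, ⟨i, hmem⟩, hbound.trans (Finset.le_sup' e hmem)⟩
end

section
/- Global error bound for regression (Theorem 2). Assume the index type ι is nonempty. For every feasible input x ∈ X̃ and every possible ground truth y ∈ f̂(x), |f(x) − y| ≤ e_global, where e_global is the maximum of eᵢ over all indices i ∈ ι. -/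
/-- **Global error bound for regression (Theorem 2).**
For every feasible input `x ∈ X̃` and every possible ground truth `y ∈ f̂ x`,
`|f x - y| ≤ e_global`, where `e_global` is the maximum of `e i` over all `i`. -/
theorem global_error_bound_regression
    {X : Type*} {ι : Type*} [Fintype ι] [Nonempty ι]
    (Xfeas : Set X) (fhat : X → Set ℝ) (f : X → ℝ)
    (T : ι → Set X) (l u : ι → ℝ) (B : ι → Set X) (l' u' : ι → ℝ)
    (e : ι → ℝ) (he : ∀ i, e i = max (u' i - l i) (u i - l' i))
    (h41 : Xfeas ⊆ ⋃ i, T i)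
    (h42a : ∀ x ∈ Xfeas, ∀ y ∈ fhat x, ∃ i, x ∈ T i ∧ l i ≤ y ∧ y ≤ u i)
    (h43 : ∀ i, T i ⊆ B i)
    (h44a : ∀ i, ∀ x ∈ B i, l' i ≤ f x ∧ f x ≤ u' i)
    (x : X) (hx : x ∈ Xfeas) (y : ℝ) (hy : y ∈ fhat x) :
    |f x - y| ≤ Finset.univ.sup' Finset.univ_nonempty e := by
  obtain ⟨i, hxi, hly, hyu⟩ := h42a x hx y hy
  obtain ⟨hl, hu⟩ := h44a i x (h43 i hxi)
  refine le_trans ?_ (Finset.le_sup' e (Finset.mem_univ i))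
  rw [he i, abs_le']
  exact ⟨le_max_of_le_left (by linarith), le_max_of_le_right (by linarith)⟩
end

section
/- Local error bound for classification (Theorem 3). Let x ∈ X̃ be a feasible input with f̂(x) nonempty. If every index i with x ∈ Bᵢ is verified, then there is a class c ∈ Fin K such that f̂(x) = {c} and o(x)(c) > o(x)(k) for every k ≠ c; that is, the network's prediction at x is guaranteed to equal the unique ground truth. -/
/-- **Local error bound for classification (Theorem 3).**
Let `x ∈ X̃` be a feasible input with `f̂ x` nonempty. If every index `i` with
`x ∈ B i` is verified (i.e. `C i` is a singleton `{c}` and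
`l' i c > u' i k` for every `k ≠ c`), then there is a class `c` such that
`f̂ x = {c}` and `o x c > o x k` for every `k ≠ c`: the network's prediction at
`x` is guaranteed to equal the unique ground truth. -/
theorem local_error_bound_classification
    {X : Type*} {ι : Type*} [Fintype ι] {K : ℕ} (hK : 1 ≤ K)
    (Xfeas : Set X) (fhat : X → Set (Fin K)) (o : X → Fin K → ℝ)
    (T : ι → Set X) (C : ι → Set (Fin K)) (B : ι → Set X)
    (l' u' : ι → Fin K → ℝ)
    (h41 : Xfeas ⊆ ⋃ i, T i)
    (h42b : ∀ x ∈ Xfeas, ∀ y ∈ fhat x, ∃ i, x ∈ T i ∧ y ∈ C i)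
    (h43 : ∀ i, T i ⊆ B i)
    (h44b : ∀ i, ∀ x ∈ B i, ∀ k, l' i k ≤ o x k ∧ o x k ≤ u' i k)
    (x : X) (hx : x ∈ Xfeas) (hfx : (fhat x).Nonempty)
    (hverified : ∀ i, x ∈ B i →
      ∃ c, C i = {c} ∧ ∀ k, k ≠ c → u' i k < l' i c) :
    ∃ c, fhat x = {c} ∧ ∀ k, k ≠ c → o x k < o x c := by
  have score_lt : ∀ y ∈ fhat x, ∀ k, k ≠ y → o x k < o x y := by
    intro y hy k hk
    obtain ⟨i, hxi, hyi⟩ := h42b x hx y hy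
    have hxB : x ∈ B i := h43 i hxi
    obtain ⟨c, hc, hlt⟩ := hverified i hxB
    obtain rfl : y = c := by simpa [hc] using hyi
    calc o x k ≤ u' i k := (h44b i x hxB k).2
      _ < l' i y := hlt k hk
      _ ≤ o x y := (h44b i x hxB y).1
  obtain ⟨y, hy⟩ := hfx
  refine ⟨y, Set.eq_singleton_iff_unique_mem.2 ⟨hy, fun z hz => ?_⟩, score_lt y hy⟩
  by_contra hzy
  exact lt_asymm (score_lt y hy z hzy) (score_lt z hz y (Ne.symm hzy))
end

section
/- Global error bound for classification (Theorem 4). If every index i ∈ ι is verified, then for every feasible input x ∈ X̃ with f̂(x) nonempty there is a class c ∈ Fin K such that f̂(x) = {c} and o(x)(c) > o(x)(k) for every k ≠ c; that is, the network's prediction is guaranteed to be correct on all of X̃. -/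
/-- **Global error bound for classification (Theorem 4).**
If every index `i` is verified (i.e. `C i` is a singleton `{c}` and
`l' i c > u' i k` for every `k ≠ c`), then for every feasible input `x ∈ X̃`
with `f̂ x` nonempty there is a class `c` such that `f̂ x = {c}` and
`o x c > o x k` for every `k ≠ c`: the network's prediction is guaranteed to
be correct on all of `X̃`. -/
theorem global_error_bound_classification
    {X : Type*} {ι : Type*} [Fintype ι] {K : ℕ} (hK : 1 ≤ K)
    (Xfeas : Set X) (fhat : X → Set (Fin K)) (o : X → Fin K → ℝ)
    (T : ι → Set X) (C : ι → Set (Fin K)) (B : ι → Set X)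
    (l' u' : ι → Fin K → ℝ)
    (h41 : Xfeas ⊆ ⋃ i, T i)
    (h42b : ∀ x ∈ Xfeas, ∀ y ∈ fhat x, ∃ i, x ∈ T i ∧ y ∈ C i)
    (h43 : ∀ i, T i ⊆ B i)
    (h44b : ∀ i, ∀ x ∈ B i, ∀ k, l' i k ≤ o x k ∧ o x k ≤ u' i k)
    (hverified : ∀ i, ∃ c, C i = {c} ∧ ∀ k, k ≠ c → u' i k < l' i c) :
    ∀ x ∈ Xfeas, (fhat x).Nonempty →
      ∃ c, fhat x = {c} ∧ ∀ k, k ≠ c → o x k < o x c := by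
  have key : ∀ x ∈ Xfeas, ∀ y ∈ fhat x, ∀ k, k ≠ y → o x k < o x y := by
    intro x hx y hy k hk
    obtain ⟨i, hxT, hyC⟩ := h42b x hx y hy
    obtain ⟨c, hc, hlt⟩ := hverified i
    obtain rfl : y = c := by simpa [hc] using hyC
    have hb := h44b i x (h43 i hxT)
    exact (hb k).2.trans_lt ((hlt k hk).trans_le (hb y).1)
  rintro x hx ⟨c, hc⟩
  refine ⟨c, Set.eq_singleton_iff_unique_mem.2 ⟨hc, fun y hy => ?_⟩, key x hx c hc⟩
  by_contra hne
  exact lt_asymm (key x hx c hc y hne) (key x hx y hy c (Ne.symm hne))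
end
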